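/- arXiv:2205.08103 — 2 statements merged into one kernel-verified Lean document; each statement's English description precedes it below -/
import Mathlib

section
/- (Duality) For every k-server instance on a metric space and every 1 ≤ t ≤ T: if a configuration X ∈ Ω^k attains the infimum over Y ∈ Ω^k of w_{t−1}(Y) − d(Y, r_t^k), then X maximizes the increase of the work function, i.e., for every configuration Y ∈ Ω^k, w_t(X) − w_{t−1}(X) ≥ w_t(Y) − w_{t−1}(Y). -/
open Finset

/-- Minimum-matching (Wasserstein) distance between two `k`-point configurations,
represented as `k`-tuples of points. -/
noncomputable def confDist {Ω : Type*} [MetricSpace Ω] {k : ℕ} (X Y : Fin k → Ω) : ℝ :=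
  ⨅ σ : Equiv.Perm (Fin k), ∑ i, dist (X i) (Y (σ i))

/-- The work function at time `t` of the `k`-server instance with initial configuration
`X₀` and requests `r 1, r 2, …` (the value `r 0` is unused): the least cost of serving
the first `t` requests and then moving to the configuration `X`. -/
noncomputable def workFn {Ω : Type*} [MetricSpace Ω] (k : ℕ) (X₀ : Fin k → Ω)
    (r : ℕ → Ω) (t : ℕ) (X : Fin k → Ω) : ℝ :=
  sInf { c : ℝ | ∃ Y : ℕ → Fin k → Ω, Y 0 = X₀ ∧
    (∀ i ∈ Finset.Icc 1 t, ∃ j, Y i j = r i) ∧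
    c = (∑ i ∈ Finset.Icc 1 t, confDist (Y (i - 1)) (Y i)) + confDist (Y t) X }

/-- The offline optimum of the `k`-server instance with initial configuration `X₀`
and requests `r 1, …, r T`. -/
noncomputable def opt {Ω : Type*} [MetricSpace Ω] (k : ℕ) (X₀ : Fin k → Ω)
    (r : ℕ → Ω) (T : ℕ) : ℝ :=
  sInf { c : ℝ | ∃ Y : ℕ → Fin k → Ω, Y 0 = X₀ ∧
    (∀ i ∈ Finset.Icc 1 T, ∃ j, Y i j = r i) ∧
    c = ∑ i ∈ Finset.Icc 1 T, confDist (Y (i - 1)) (Y i) }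

/-- `OPT_t(Z)`: the least cost of serving the first `t` requests while ending
in the configuration `Z`. -/
noncomputable def optTo {Ω : Type*} [MetricSpace Ω] (k : ℕ) (X₀ : Fin k → Ω)
    (r : ℕ → Ω) (t : ℕ) (Z : Fin k → Ω) : ℝ :=
  sInf { c : ℝ | ∃ Y : ℕ → Fin k → Ω, Y 0 = X₀ ∧
    (∀ i ∈ Finset.Icc 1 t, ∃ j, Y i j = r i) ∧ Y t = Z ∧
    c = ∑ i ∈ Finset.Icc 1 t, confDist (Y (i - 1)) (Y i) }

/-- `X 0, X 1, …, X T` is a run of the work function algorithm on the `k`-server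
instance with initial configuration `X₀` and requests `r 1, …, r T`. -/
def IsWFARun {Ω : Type*} [MetricSpace Ω] (k : ℕ) (X₀ : Fin k → Ω)
    (r : ℕ → Ω) (T : ℕ) (X : ℕ → Fin k → Ω) : Prop :=
  X 0 = X₀ ∧ ∀ t, 1 ≤ t → t ≤ T →
    (∃ j, X t j = r t) ∧
    ∀ Z : Fin k → Ω, (∃ j, Z j = r t) →
      optTo k X₀ r t (X t) + confDist (X t) (X (t - 1)) ≤
        optTo k X₀ r t Z + confDist Z (X (t - 1))

section ConfDist

variable {Ω : Type*} [MetricSpace Ω] {k : ℕ}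

lemma confDist_le_sum (X Y : Fin k → Ω) (σ : Equiv.Perm (Fin k)) :
    confDist X Y ≤ ∑ i, dist (X i) (Y (σ i)) :=
  ciInf_le (Set.finite_range _).bddBelow σ

lemma exists_confDist_eq_sum (X Y : Fin k → Ω) :
    ∃ σ : Equiv.Perm (Fin k), ∑ i, dist (X i) (Y (σ i)) = confDist X Y :=
  exists_eq_ciInf_of_finite

lemma confDist_nonneg (X Y : Fin k → Ω) : 0 ≤ confDist X Y :=
  le_ciInf fun _ => Finset.sum_nonneg fun _ _ => dist_nonneg

lemma confDist_triangle (X Y Z : Fin k → Ω) :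
    confDist X Z ≤ confDist X Y + confDist Y Z := by
  obtain ⟨σ, hσ⟩ := exists_confDist_eq_sum X Y
  obtain ⟨τ, hτ⟩ := exists_confDist_eq_sum Y Z
  rw [← hσ, ← hτ, ← Equiv.sum_comp σ (fun i => dist (Y i) (Z (τ i))), ← Finset.sum_add_distrib]
  exact (confDist_le_sum X Z (σ.trans τ)).trans
    (Finset.sum_le_sum fun i _ => dist_triangle _ _ _)

lemma confDist_comp_perm (X Y : Fin k → Ω) (π : Equiv.Perm (Fin k)) :
    confDist X (Y ∘ π) = confDist X Y :=
  (Equiv.mulLeft π).iInf_comp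
    (g := fun σ : Equiv.Perm (Fin k) => ∑ i, dist (X i) (Y (σ i)))

lemma confDist_const (X : Fin k → Ω) (p : Ω) :
    confDist X (fun _ => p) = ∑ i, dist (X i) p :=
  ciInf_const

lemma confDist_update_le (X : Fin k → Ω) (x : Fin k) (p : Ω) :
    confDist (Function.update X x p) X ≤ dist p (X x) := by
  refine (confDist_le_sum _ X 1).trans (le_of_eq ?_)
  rw [Finset.sum_eq_single x]
  · simp
  · intro i _ hi
    simp [hi]
  · simp

lemma exists_confDist_update_add_le (X Y : Fin k → Ω) (j : Fin k) :
    ∃ x, confDist Y (Function.update X x (Y j)) + dist (Y j) (X x) ≤ confDist Y X := by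
  obtain ⟨σ, hσ⟩ := exists_confDist_eq_sum Y X
  refine ⟨σ j, ?_⟩
  have h := confDist_le_sum Y (Function.update X (σ j) (Y j)) σ
  rw [← Finset.add_sum_erase _ _ (Finset.mem_univ j)] at hσ h
  have heq : ∑ i ∈ Finset.univ.erase j, dist (Y i) (Function.update X (σ j) (Y j) (σ i)) =
      ∑ i ∈ Finset.univ.erase j, dist (Y i) (X (σ i)) := by
    refine Finset.sum_congr rfl fun i hi => ?_
    rw [Function.update_of_ne (σ.injective.ne (Finset.ne_of_mem_erase hi))]
  rw [heq] at h
  simp only [Function.update_self, dist_self] at h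
  linarith

end ConfDist

section WorkFn

variable {Ω : Type*} [MetricSpace Ω] {k : ℕ}

lemma workFn_le (X₀ : Fin k → Ω) (r : ℕ → Ω) (t : ℕ) (X : Fin k → Ω)
    (Y : ℕ → Fin k → Ω) (h0 : Y 0 = X₀) (hY : ∀ i ∈ Finset.Icc 1 t, ∃ j, Y i j = r i) :
    workFn k X₀ r t X ≤
      (∑ i ∈ Finset.Icc 1 t, confDist (Y (i - 1)) (Y i)) + confDist (Y t) X := by
  refine csInf_le ⟨0, ?_⟩ ⟨Y, h0, hY, rfl⟩
  rintro c ⟨Z, -, -, rfl⟩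
  exact add_nonneg (Finset.sum_nonneg fun _ _ => confDist_nonneg _ _) (confDist_nonneg _ _)

lemma le_workFn (hk : 1 ≤ k) (X₀ : Fin k → Ω) (r : ℕ → Ω) (t : ℕ) (X : Fin k → Ω) (c : ℝ)
    (h : ∀ Y : ℕ → Fin k → Ω, Y 0 = X₀ → (∀ i ∈ Finset.Icc 1 t, ∃ j, Y i j = r i) →
      c ≤ (∑ i ∈ Finset.Icc 1 t, confDist (Y (i - 1)) (Y i)) + confDist (Y t) X) :
    c ≤ workFn k X₀ r t X := by
  refine le_csInf ⟨_, fun i => if i = 0 then X₀ else fun _ => r i, by simp, ?_, rfl⟩ ?_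
  · intro i hi
    have hi0 : i ≠ 0 := Nat.one_le_iff_ne_zero.mp (Finset.mem_Icc.mp hi).1
    exact ⟨⟨0, hk⟩, by simp [hi0]⟩
  · rintro _ ⟨Y, h0, hY, rfl⟩
    exact h Y h0 hY

lemma workFn_zero (hk : 1 ≤ k) (X₀ : Fin k → Ω) (r : ℕ → Ω) (X : Fin k → Ω) :
    workFn k X₀ r 0 X = confDist X₀ X := by
  apply le_antisymm
  · simpa using workFn_le X₀ r 0 X (fun _ => X₀) rfl (by simp)
  · refine le_workFn hk X₀ r 0 X _ ?_
    rintro Y rfl -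
    simp

lemma workFn_comp_perm (X₀ : Fin k → Ω) (r : ℕ → Ω) (t : ℕ) (X : Fin k → Ω)
    (π : Equiv.Perm (Fin k)) : workFn k X₀ r t (X ∘ π) = workFn k X₀ r t X := by
  simp only [workFn, confDist_comp_perm]

lemma workFn_succ_le (hk : 1 ≤ k) (X₀ : Fin k → Ω) (r : ℕ → Ω) (t : ℕ) (X : Fin k → Ω)
    (x : Fin k) :
    workFn k X₀ r (t + 1) X ≤
      workFn k X₀ r t (Function.update X x (r (t + 1))) + dist (r (t + 1)) (X x) := by
  rw [← sub_le_iff_le_add]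
  refine le_workFn hk X₀ r t _ _ fun Y h0 hY => ?_
  have h := workFn_le X₀ r (t + 1) X
    (Function.update Y (t + 1) (Function.update X x (r (t + 1))))
    (by rw [Function.update_of_ne (Nat.succ_ne_zero t).symm, h0]) (by
      intro i hi
      rcases eq_or_ne i (t + 1) with rfl | hne
      · exact ⟨x, by simp⟩
      · rw [Function.update_of_ne hne]
        simp only [Finset.mem_Icc] at hi
        exact hY i (Finset.mem_Icc.mpr (by omega)))
  rw [Finset.sum_Icc_succ_top (by omega)] at h
  have heq : ∑ i ∈ Finset.Icc 1 t, confDist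
      (Function.update Y (t + 1) (Function.update X x (r (t + 1))) (i - 1))
      (Function.update Y (t + 1) (Function.update X x (r (t + 1))) i) =
      ∑ i ∈ Finset.Icc 1 t, confDist (Y (i - 1)) (Y i) := by
    refine Finset.sum_congr rfl fun i hi => ?_
    simp only [Finset.mem_Icc] at hi
    rw [Function.update_of_ne (by omega), Function.update_of_ne (by omega)]
  rw [heq] at h
  simp only [Function.update_self, Nat.add_sub_cancel,
    Function.update_of_ne (Nat.lt_succ_self t).ne] at h
  have := confDist_update_le X x (r (t + 1))
  linarith

lemma exists_le_workFn_succ (hk : 1 ≤ k) (X₀ : Fin k → Ω) (r : ℕ → Ω) (t : ℕ)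
    (X : Fin k → Ω) :
    ∃ x, workFn k X₀ r t (Function.update X x (r (t + 1))) + dist (r (t + 1)) (X x) ≤
      workFn k X₀ r (t + 1) X := by
  have : Nonempty (Fin k) := ⟨⟨0, hk⟩⟩
  obtain ⟨x, hx⟩ := Finite.exists_min fun x =>
    workFn k X₀ r t (Function.update X x (r (t + 1))) + dist (r (t + 1)) (X x)
  refine ⟨x, le_workFn hk X₀ r (t + 1) X _ fun Y h0 hY => ?_⟩
  obtain ⟨j, hj⟩ := hY (t + 1) (by simp)
  obtain ⟨z, hz⟩ := exists_confDist_update_add_le X (Y (t + 1)) j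
  rw [hj] at hz
  have h := workFn_le X₀ r t (Function.update X z (r (t + 1))) Y h0 fun i hi =>
    hY i (Finset.Icc_subset_Icc_right (Nat.le_succ t) hi)
  have htri := confDist_triangle (Y t) (Y (t + 1)) (Function.update X z (r (t + 1)))
  have hxz := hx z
  rw [Finset.sum_Icc_succ_top (by omega), Nat.add_sub_cancel]
  linarith

end WorkFn

section QuasiConvex

variable {Ω : Type*} {k : ℕ}

/-- Exchanging any set of points between `A` and `B` along the matching `σ` does not increase
`w A + w B`. -/
def IsExchangeMatching (w : (Fin k → Ω) → ℝ) (A B : Fin k → Ω) (σ : Equiv.Perm (Fin k)) : Prop :=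
  ∀ S : Finset (Fin k), w (S.piecewise (B ∘ σ) A) + w (S.piecewise A (B ∘ σ)) ≤ w A + w B

/-- Any two configurations admit an exchange matching. -/
def IsQuasiConvex (w : (Fin k → Ω) → ℝ) : Prop :=
  ∀ A B : Fin k → Ω, ∃ σ, IsExchangeMatching w A B σ

lemma IsExchangeMatching.mul_swap {w : (Fin k → Ω) → ℝ}
    (hw : ∀ X (π : Equiv.Perm (Fin k)), w (X ∘ π) = w X) {A B : Fin k → Ω}
    {σ : Equiv.Perm (Fin k)} (h : IsExchangeMatching w A B σ) {x a : Fin k}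
    (hxa : A x = B (σ a)) : IsExchangeMatching w A B (σ * Equiv.swap x a) := by
  intro S
  rcases eq_or_ne x a with rfl | hne
  · simpa using h S
  by_cases ha : a ∈ S
  · have hP : S.piecewise (B ∘ ⇑(σ * Equiv.swap x a)) A =
        (insert x S).piecewise (B ∘ σ) A ∘ Equiv.swap x a := by
      ext i
      rcases eq_or_ne i x with rfl | hix
      · by_cases hi : i ∈ S <;> simp [Finset.piecewise, ha, hi, hxa]
      rcases eq_or_ne i a with rfl | hia
      · simp [Finset.piecewise, ha]
      · simp [Finset.piecewise, Equiv.swap_apply_of_ne_of_ne hix hia, hix]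
    have hN : S.piecewise A (B ∘ ⇑(σ * Equiv.swap x a)) =
        (insert x S).piecewise A (B ∘ σ) := by
      ext i
      rcases eq_or_ne i x with rfl | hix
      · by_cases hi : i ∈ S <;> simp [Finset.piecewise, hi, hxa]
      rcases eq_or_ne i a with rfl | hia
      · simp [Finset.piecewise, ha]
      · simp [Finset.piecewise, Equiv.swap_apply_of_ne_of_ne hix hia, hix]
    rw [hP, hN, hw]
    exact h _
  · have hP : S.piecewise (B ∘ ⇑(σ * Equiv.swap x a)) A =
        (S.erase x).piecewise (B ∘ σ) A := by
      ext i
      rcases eq_or_ne i x with rfl | hix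
      · by_cases hi : i ∈ S <;> simp [Finset.piecewise, hi, hxa]
      rcases eq_or_ne i a with rfl | hia
      · simp [Finset.piecewise, ha]
      · simp [Finset.piecewise, Equiv.swap_apply_of_ne_of_ne hix hia, hix]
    have hN : S.piecewise A (B ∘ ⇑(σ * Equiv.swap x a)) =
        (S.erase x).piecewise A (B ∘ σ) ∘ Equiv.swap x a := by
      ext i
      rcases eq_or_ne i x with rfl | hix
      · by_cases hi : i ∈ S <;> simp [Finset.piecewise, ha, hi, hxa]
      rcases eq_or_ne i a with rfl | hia
      · simp [Finset.piecewise, ha]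
      · simp [Finset.piecewise, Equiv.swap_apply_of_ne_of_ne hix hia, hix]
    rw [hP, hN, hw]
    exact h _

/-- A common point of two configurations may be assumed to be matched to itself. -/
lemma IsQuasiConvex.exists_matching_apply_eq {w : (Fin k → Ω) → ℝ}
    (hw : ∀ X (π : Equiv.Perm (Fin k)), w (X ∘ π) = w X) (hq : IsQuasiConvex w)
    {A B : Fin k → Ω} {x y : Fin k} (hxy : A x = B y) :
    ∃ σ, IsExchangeMatching w A B σ ∧ σ x = y := by
  obtain ⟨σ, hσ⟩ := hq A B
  exact ⟨σ * Equiv.swap x (σ.symm y), hσ.mul_swap hw (by simpa using hxy), by simp⟩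

variable [MetricSpace Ω]

lemma isQuasiConvex_confDist (X₀ : Fin k → Ω) : IsQuasiConvex (confDist X₀) := by
  intro A B
  obtain ⟨α, hα⟩ := exists_confDist_eq_sum X₀ A
  obtain ⟨β, hβ⟩ := exists_confDist_eq_sum X₀ B
  refine ⟨α.symm.trans β, fun S => ?_⟩
  rw [← hα, ← hβ, ← Finset.sum_add_distrib]
  refine (add_le_add (confDist_le_sum _ _ α) (confDist_le_sum _ _ α)).trans (le_of_eq ?_)
  rw [← Finset.sum_add_distrib]
  refine Finset.sum_congr rfl fun i _ => ?_
  by_cases hi : α i ∈ S <;> simp [Finset.piecewise, hi, add_comm]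

lemma IsQuasiConvex.of_serve_request {w w' : (Fin k → Ω) → ℝ} {p : Ω}
    (hw : ∀ X (π : Equiv.Perm (Fin k)), w (X ∘ π) = w X) (hq : IsQuasiConvex w)
    (hle : ∀ X x, w' X ≤ w (Function.update X x p) + dist p (X x))
    (hge : ∀ X, ∃ x, w (Function.update X x p) + dist p (X x) ≤ w' X) :
    IsQuasiConvex w' := by
  intro A B
  obtain ⟨x, hx⟩ := hge A
  obtain ⟨y, hy⟩ := hge B
  obtain ⟨σ, hσ, rfl⟩ := hq.exists_matching_apply_eq hw
    (A := Function.update A x p) (B := Function.update B y p) (x := x) (y := y) (by simp)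
  refine ⟨σ, fun S => ?_⟩
  have hS := hσ S
  rw [Function.update_comp_eq_of_injective _ σ.injective, ← Finset.update_piecewise,
    ← Finset.update_piecewise] at hS
  have h₁ := hle (S.piecewise (B ∘ σ) A) x
  have h₂ := hle (S.piecewise A (B ∘ σ)) x
  by_cases hxS : x ∈ S
  · simp only [Finset.piecewise_eq_of_mem _ _ _ hxS, Function.comp_apply] at h₁ h₂
    linarith
  · simp only [Finset.piecewise_eq_of_notMem _ _ _ hxS, Function.comp_apply] at h₁ h₂
    linarith

lemma isQuasiConvex_workFn (hk : 1 ≤ k) (X₀ : Fin k → Ω) (r : ℕ → Ω) (t : ℕ) :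
    IsQuasiConvex (workFn k X₀ r t) := by
  induction t with
  | zero =>
    rw [funext (workFn_zero hk X₀ r)]
    exact isQuasiConvex_confDist X₀
  | succ t ih =>
    exact ih.of_serve_request (workFn_comp_perm X₀ r t) (workFn_succ_le hk X₀ r t)
      (exists_le_workFn_succ hk X₀ r t)

end QuasiConvex

/-- A single point of `A` can be exchanged with some point of `B`. -/
lemma IsQuasiConvex.exists_exchange {Ω : Type*} {k : ℕ} {w : (Fin k → Ω) → ℝ}
    (hw : ∀ X (π : Equiv.Perm (Fin k)), w (X ∘ π) = w X) (hq : IsQuasiConvex w)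
    (A B : Fin k → Ω) (x : Fin k) :
    ∃ y, w (Function.update A x (B y)) + w (Function.update B y (A x)) ≤ w A + w B := by
  obtain ⟨σ, hσ⟩ := hq A B
  refine ⟨σ x, ?_⟩
  have h := hσ {x}
  rw [Finset.piecewise_singleton, Finset.piecewise_singleton,
    ← Function.update_comp_eq_of_injective _ σ.injective, hw] at h
  exact h

/-- Duality: a configuration `X` minimizing `w_{t-1}(Y) − d(Y, r_t^k)` maximizes the
increase `w_t − w_{t-1}` of the work function. -/
theorem workFn_duality {Ω : Type*} [MetricSpace Ω] (k : ℕ) (hk : 1 ≤ k)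
    (X₀ : Fin k → Ω) (r : ℕ → Ω) (T t : ℕ) (ht : 1 ≤ t) (htT : t ≤ T)
    (X : Fin k → Ω)
    (hX : ∀ Y : Fin k → Ω,
      workFn k X₀ r (t - 1) X - confDist X (fun _ => r t) ≤
        workFn k X₀ r (t - 1) Y - confDist Y (fun _ => r t)) :
    ∀ Y : Fin k → Ω,
      workFn k X₀ r t X - workFn k X₀ r (t - 1) X ≥
        workFn k X₀ r t Y - workFn k X₀ r (t - 1) Y := by
  intro Y
  obtain ⟨t, rfl⟩ : ∃ s, t = s + 1 := ⟨t - 1, by omega⟩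
  rw [Nat.add_sub_cancel] at *
  obtain ⟨x, hx⟩ := exists_le_workFn_succ hk X₀ r t X
  obtain ⟨y, hy⟩ := (isQuasiConvex_workFn hk X₀ r t).exists_exchange
    (workFn_comp_perm X₀ r t) (Function.update X x (r (t + 1))) Y x
  rw [Function.update_idem, Function.update_self] at hy
  have hY := workFn_succ_le hk X₀ r t Y y
  have hmin := hX (Function.update X x (Y y))
  have heq : ∑ i ∈ Finset.univ.erase x, dist (Function.update X x (Y y) i) (r (t + 1)) =
      ∑ i ∈ Finset.univ.erase x, dist (X i) (r (t + 1)) :=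
    Finset.sum_congr rfl fun i hi => by
      rw [Function.update_of_ne (Finset.ne_of_mem_erase hi)]
  rw [confDist_const, confDist_const, ← Finset.add_sum_erase _ _ (Finset.mem_univ x),
    ← Finset.add_sum_erase _ _ (Finset.mem_univ x), heq, Function.update_self,
    dist_comm (X x), dist_comm (Y y)] at hmin
  linarith
end

section
/- Let (Ω,d) be a metric space with antipodes of diameter Δ, let k ≥ 1, and let w be a real-valued function on k-point multisets of Ω that is 1-Lipschitz (|w(X) − w(Y)| ≤ d(X,Y) for the minimum-matching distance d on multisets). Then inf over u ∈ Ω and (x_{i,j})_{i ∈ {1,…,k}, j ∈ {1,…,k−1}} of [ w(ū^k) + Σ_{i=1}^k w({u, x_{i,1},…,x_{i,k−1}}) − Σ_{1 ≤ i < j ≤ k} Σ_{ℓ=i}^{k−1} d(x_{i,ℓ}, x_{j,i}) ] equals inf over x_1,…,x_k ∈ Ω of Σ_{i=1}^{k+1} w(x̄_{i−1}^{i−1} ∪ {x_i, x_{i+1},…,x_k}) − Δ·Σ_{j=1}^{k−1} j², where the i-th summand is w evaluated on the multiset consisting of i−1 copies of the antipode x̄_{i−1} together with the points x_i,…,x_k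 (so the first summand is w({x_1,…,x_k}) and the (k+1)-st summand is w(x̄_k^k)). -/
open Finset

section Antipodes

variable {Ω : Type*} [MetricSpace Ω]

/-- The configuration distance is at most the cost of any matching. -/
lemma confDist_le_sum_perm {k : ℕ} (X Y : Fin k → Ω) (σ : Equiv.Perm (Fin k)) :
    confDist X Y ≤ ∑ i, dist (X i) (Y (σ i)) :=
  ciInf_le ⟨0, by rintro _ ⟨τ, rfl⟩; exact Finset.sum_nonneg fun _ _ => dist_nonneg⟩ σ

/-- A function that is 1-Lipschitz for the configuration distance is symmetric. -/
lemma apply_eq_of_perm {k : ℕ} {w : (Fin k → Ω) → ℝ}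
    (hw : ∀ X Y, |w X - w Y| ≤ confDist X Y) {X Y : Fin k → Ω} (σ : Equiv.Perm (Fin k))
    (h : ∀ i, X i = Y (σ i)) : w X = w Y := by
  have h1 := (hw X Y).trans (confDist_le_sum_perm X Y σ)
  simp only [h, dist_self, Finset.sum_const_zero] at h1
  exact sub_eq_zero.mp (abs_eq_zero.mp (le_antisymm h1 (abs_nonneg _)))

lemma apply_sub_le_sum_dist {k : ℕ} {w : (Fin k → Ω) → ℝ}
    (hw : ∀ X Y, |w X - w Y| ≤ confDist X Y) (X Y : Fin k → Ω) :
    w X - w Y ≤ ∑ i, dist (X i) (Y i) :=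
  (le_abs_self _).trans ((hw X Y).trans (by simpa using confDist_le_sum_perm X Y 1))

/-- Two families of `n` points have a common approximate median: its total distance to all
the points is at most the sum of the distances between the two families. -/
lemma exists_sum_dist_add_le {ι κ : Type*} [Nonempty Ω] (A : Finset ι) (B : Finset κ)
    (hAB : A.card = B.card) (p : ι → Ω) (r : κ → Ω) :
    ∃ a, ∑ l ∈ A, dist (p l) a + ∑ j ∈ B, dist (r j) a ≤
      ∑ j ∈ B, ∑ l ∈ A, dist (p l) (r j) := by
  classical
  rcases A.eq_empty_or_nonempty with rfl | hA
  · have hB : B = ∅ := by simpa using hAB.symm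
    subst hB
    exact ⟨Classical.arbitrary Ω, by simp⟩
  by_contra! hcon
  set S := ∑ j ∈ B, ∑ l ∈ A, dist (p l) (r j) with hS
  set n : ℝ := (A.card : ℝ) with hn
  have hnB : (B.card : ℝ) = n := by rw [hn, hAB]
  have hn1 : 1 ≤ A.card := hA.card_pos
  have hS0 : 0 ≤ S := Finset.sum_nonneg fun _ _ => Finset.sum_nonneg fun _ _ => dist_nonneg
  set D := ∑ a ∈ A, ∑ l ∈ A, dist (p l) (p a)
  have hlt : n * S < D + S := by
    have h := Finset.sum_lt_sum_of_nonempty hA fun i _ => hcon (p i)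
    rw [Finset.sum_const, nsmul_eq_mul, Finset.sum_add_distrib] at h
    have h2 : ∑ i ∈ A, ∑ j ∈ B, dist (r j) (p i) = S := by
      rw [hS, Finset.sum_comm]
      simp only [dist_comm]
    rwa [h2] at h
  have hD_le : n * D ≤ 2 * (n - 1) * S := by
    have hpt : ∀ a ∈ A, ∀ l ∈ A, n * dist (p l) (p a) ≤
        ∑ j ∈ B, (dist (p l) (r j) + dist (p a) (r j)) -
          if l = a then 2 * ∑ j ∈ B, dist (p a) (r j) else 0 := by
      intro a _ l _
      split_ifs with h
      · subst h
        simp [Finset.sum_add_distrib, two_mul]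
      · rw [sub_zero, ← hnB, ← nsmul_eq_mul, ← Finset.sum_const]
        exact Finset.sum_le_sum fun j _ => dist_triangle_right _ _ _
    have h := Finset.sum_le_sum fun a ha => Finset.sum_le_sum (hpt a ha)
    have h1 : ∑ a ∈ A, ∑ j ∈ B, dist (p a) (r j) = S := by rw [hS, Finset.sum_comm]
    simp only [← Finset.mul_sum, Finset.sum_sub_distrib, Finset.sum_add_distrib,
      Finset.sum_const, nsmul_eq_mul, Finset.sum_ite_eq', h1] at h
    rw [Finset.sum_congr rfl fun a ha => if_pos ha, ← Finset.mul_sum, h1] at h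
    linarith
  have hn1' : (1 : ℝ) ≤ n := Nat.one_le_cast.mpr hn1
  have hpos : 0 ≤ (n - 1) * (n - 2) := by
    rcases hn1.eq_or_lt with h | h
    · have : n = 1 := by rw [hn, ← h]; simp
      simp [this]
    · have : (2 : ℝ) ≤ n := Nat.ofNat_le_cast.mpr h
      exact mul_nonneg (by linarith) (by linarith)
  nlinarith [mul_nonneg hpos hS0, mul_lt_mul_of_pos_left hlt (by linarith : 0 < n)]

variable {Δ : ℝ} {bar : Ω → Ω}

lemma bar_bar_of_antipodes (hbar : ∀ x y : Ω, dist x y + dist y (bar x) = Δ) (x : Ω) :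
    bar (bar x) = x := by
  have h1 := hbar x x
  have h2 := hbar (bar x) x
  rw [dist_self, zero_add] at h1
  rw [dist_comm, h1, add_eq_left] at h2
  exact (dist_eq_zero.mp h2).symm

lemma dist_le_of_antipodes (hbar : ∀ x y : Ω, dist x y + dist y (bar x) = Δ) (x y : Ω) :
    dist x y ≤ Δ := by
  linarith [hbar x y, dist_nonneg (x := y) (y := bar x)]

/-- Two families of `n` points can be moved to a single point and to its antipode,
respectively, at a cost that is made up for by the gain in total mutual distance. -/
lemma exists_sum_dist_bar_le [Nonempty Ω] {ι κ : Type*}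
    (hbar : ∀ x y : Ω, dist x y + dist y (bar x) = Δ) (A : Finset ι) (B : Finset κ)
    (hAB : A.card = B.card) (p : ι → Ω) (q : κ → Ω) :
    ∃ b, ∑ l ∈ A, dist (p l) (bar b) + ∑ j ∈ B, dist (q j) b ≤
      Δ * (A.card : ℝ) ^ 2 - ∑ j ∈ B, ∑ l ∈ A, dist (p l) (q j) := by
  obtain ⟨a, ha⟩ := exists_sum_dist_add_le A B hAB p fun j => bar (q j)
  refine ⟨bar a, ?_⟩
  rw [bar_bar_of_antipodes hbar]
  have h1 : ∀ j, dist (q j) (bar a) = dist (bar (q j)) a := fun j => by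
    linarith [hbar a (q j), hbar (q j) a, dist_comm a (q j), dist_comm a (bar (q j))]
  have h2 : ∀ l j, dist (p l) (bar (q j)) = Δ - dist (p l) (q j) := fun l j => by
    linarith [hbar (q j) (p l), dist_comm (p l) (q j)]
  simp only [h1]
  refine ha.trans_eq ?_
  simp only [h2, Finset.sum_sub_distrib, Finset.sum_const, nsmul_eq_mul, ← hAB]
  ring

/-- The configurations of the Coester–Koutsoupias potential, rearranged into the shape of
those of the canonical potential. -/
lemma sum_potential_eq (m : ℕ) {w : (Fin (m + 1) → Ω) → ℝ}
    (hw : ∀ X Y : Fin (m + 1) → Ω, |w X - w Y| ≤ confDist X Y) (Y : ℕ → Ω) :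
    ∑ s ∈ Finset.range (m + 2),
        w (fun j : Fin (m + 1) => if (j : ℕ) < s then bar (Y (s - 1)) else Y j) =
      w (fun _ => bar (Y m)) + ∑ i : Fin (m + 1), w (Fin.cons (Y m) fun l : Fin m =>
        if (l : ℕ) < i then Y (m - 1 - l) else bar (Y (m - 1 - i))) := by
  rw [Finset.sum_range_succ, add_comm]
  congr 1
  · congr 1
    funext j
    exact if_pos j.isLt
  rw [← Finset.sum_range_reflect, Finset.sum_range]
  refine Finset.sum_congr rfl fun i _ => ?_
  refine apply_eq_of_perm hw Fin.revPerm fun j => ?_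
  induction j using Fin.lastCases with
  | last =>
    simp
  | cast j =>
    have hj := j.isLt
    have hi := i.isLt
    have h1 : m + 1 - 1 - (i : ℕ) - 1 = m - 1 - i := by omega
    have h2 : m - 1 - (m - ((j : ℕ) + 1)) = j := by omega
    rw [Fin.revPerm_apply, Fin.rev_castSucc, Fin.cons_succ]
    simp only [Fin.val_castSucc, Fin.val_rev, h1, h2]
    by_cases h : (j : ℕ) < m + 1 - 1 - i
    · rw [if_pos h, if_neg (by omega)]
    · rw [if_neg h, if_pos (by omega)]

/-- The penalty of the canonical potential, grouped by the smaller of the two indices. -/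
lemma sum_penalty_eq (m : ℕ) (X : ℕ → ℕ → Ω) :
    (∑ i : Fin (m + 1), ∑ j : Fin (m + 1),
      if (i : ℕ) < (j : ℕ) then
        ∑ l ∈ (Finset.Icc (i : ℕ) (m - 1)).attach, dist (X i l.1) (X j i)
      else 0) =
    ∑ c ∈ Finset.range m, ∑ j ∈ Finset.Ico (c + 1) (m + 1), ∑ l ∈ Finset.Ico c m,
      dist (X c l) (X j c) := by
  have h : ∀ i j : ℕ, ∑ l ∈ (Finset.Icc i (m - 1)).attach, dist (X i l.1) (X j i) =
      ∑ l ∈ Finset.Icc i (m - 1), dist (X i l) (X j i) := fun i j =>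
    Finset.sum_attach (Finset.Icc i (m - 1)) fun l => dist (X i l) (X j i)
  simp only [h]
  rw [← Finset.sum_range fun i => ∑ j : Fin (m + 1), if i < (j : ℕ) then
    ∑ l ∈ Finset.Icc i (m - 1), dist (X i l) (X j i) else 0]
  have h' : ∀ i : ℕ, (∑ j : Fin (m + 1), if i < (j : ℕ) then
      ∑ l ∈ Finset.Icc i (m - 1), dist (X i l) (X j i) else 0) =
      ∑ j ∈ Finset.range (m + 1), if i < j then
        ∑ l ∈ Finset.Icc i (m - 1), dist (X i l) (X j i) else 0 := fun i =>
    (Finset.sum_range fun j => if i < j then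
      ∑ l ∈ Finset.Icc i (m - 1), dist (X i l) (X j i) else 0).symm
  simp only [h']
  rw [Finset.sum_range_succ, add_eq_left.mpr]
  · refine Finset.sum_congr rfl fun c hc => ?_
    have hc := Finset.mem_range.mp hc
    rw [← Finset.sum_filter]
    refine Finset.sum_congr (by ext; simp; omega) fun j _ => ?_
    exact Finset.sum_congr (by ext; simp; omega) fun l _ => rfl
  · exact Finset.sum_eq_zero fun j hj => if_neg (by have := Finset.mem_range.mp hj; omega)

/-- A double sum over a strip, grouped into hooks around the diagonal. -/
lemma sum_range_succ_sum_range_eq_hooks (m : ℕ) (f : ℕ → ℕ → ℝ) :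
    ∑ i ∈ Finset.range (m + 1), ∑ l ∈ Finset.range m, f i l =
      ∑ c ∈ Finset.range m, (∑ l ∈ Finset.Ico c m, f c l +
        ∑ j ∈ Finset.Ico (c + 1) (m + 1), f j c) := by
  have h : ∀ i l, f i l = (if i ≤ l then f i l else 0) + if l < i then f i l else 0 := by
    intro i l
    by_cases hil : i ≤ l
    · simp [hil, not_lt.mpr hil]
    · simp [hil, not_le.mp hil]
  rw [Finset.sum_congr rfl fun i _ => Finset.sum_congr rfl fun l _ => h i l]
  simp only [Finset.sum_add_distrib]
  congr 1
  · rw [Finset.sum_range_succ, add_eq_left.mpr]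
    · refine Finset.sum_congr rfl fun c _ => ?_
      rw [← Finset.sum_filter]
      exact Finset.sum_congr (by ext; simp; omega) fun _ _ => rfl
    · exact Finset.sum_eq_zero fun l hl =>
        if_neg (by have := Finset.mem_range.mp hl; omega)
  · rw [Finset.sum_comm]
    refine Finset.sum_congr rfl fun c _ => ?_
    rw [← Finset.sum_filter]
    exact Finset.sum_congr (by ext; simp; omega) fun _ _ => rfl

lemma sum_range_sub_sq (m : ℕ) :
    ∑ c ∈ Finset.range m, ((m - c : ℕ) : ℝ) ^ 2 = ∑ j ∈ Finset.range (m + 1), (j : ℝ) ^ 2 := by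
  rw [← Finset.sum_range_reflect (fun j => (j : ℝ) ^ 2), Finset.sum_range_succ]
  simp

/-- For the configurations of `sum_potential_eq`, all distances in the penalty equal `Δ`. -/
lemma sum_penalty_antipodal (hbar : ∀ x y : Ω, dist x y + dist y (bar x) = Δ) (m : ℕ)
    (Y : ℕ → Ω) {X : ℕ → ℕ → Ω}
    (hX : ∀ i l, X i l = if l < i then Y (m - 1 - l) else bar (Y (m - 1 - i))) :
    ∑ c ∈ Finset.range m, ∑ j ∈ Finset.Ico (c + 1) (m + 1), ∑ l ∈ Finset.Ico c m,
      dist (X c l) (X j c) = Δ * ∑ j ∈ Finset.range (m + 1), (j : ℝ) ^ 2 := by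
  rw [← sum_range_sub_sq, Finset.mul_sum]
  refine Finset.sum_congr rfl fun c hc => ?_
  have h : ∀ j ∈ Finset.Ico (c + 1) (m + 1), ∀ l ∈ Finset.Ico c m,
      dist (X c l) (X j c) = Δ := by
    intro j hj l hl
    rw [Finset.mem_Ico] at hj hl
    rw [hX, hX, if_neg (by omega), if_pos (by omega), dist_comm]
    simpa using hbar (Y (m - 1 - c)) (Y (m - 1 - c))
  rw [Finset.sum_congr rfl fun j hj => Finset.sum_congr rfl (h j hj)]
  simp only [Finset.sum_const, Nat.card_Ico, nsmul_eq_mul, Nat.add_sub_add_right]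
  ring

/-- Every value of the canonical potential is at least one whose configurations are those of
`sum_potential_eq`. -/
lemma exists_antipodal_le [Nonempty Ω]
    (hbar : ∀ x y : Ω, dist x y + dist y (bar x) = Δ) (m : ℕ) {w : (Fin (m + 1) → Ω) → ℝ}
    (hw : ∀ X Y : Fin (m + 1) → Ω, |w X - w Y| ≤ confDist X Y) (u : Ω) (X : ℕ → ℕ → Ω) :
    ∃ Y : ℕ → Ω, Y m = u ∧
      ∑ i : Fin (m + 1), w (Fin.cons u fun l : Fin m =>
          if (l : ℕ) < i then Y (m - 1 - l) else bar (Y (m - 1 - i))) -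
        Δ * ∑ j ∈ Finset.range (m + 1), (j : ℝ) ^ 2 ≤
      ∑ i : Fin (m + 1), w (Fin.cons u fun l : Fin m => X i l) -
        ∑ c ∈ Finset.range m, ∑ j ∈ Finset.Ico (c + 1) (m + 1), ∑ l ∈ Finset.Ico c m,
          dist (X c l) (X j c) := by
  choose b hb using fun c => exists_sum_dist_bar_le hbar (Finset.Ico c m)
    (Finset.Ico (c + 1) (m + 1)) (by simp) (fun l => X c l) (fun j => X j c)
  refine ⟨fun n => if n = m then u else b (m - 1 - n), if_pos rfl, ?_⟩
  set Z : ℕ → ℕ → Ω := fun i l => if l < i then b l else bar (b i) with hZ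
  have hconf : ∀ i : Fin (m + 1), (Fin.cons u fun l : Fin m =>
      if (l : ℕ) < i then (if m - 1 - (l : ℕ) = m then u else b (m - 1 - (m - 1 - l)))
      else bar (if m - 1 - (i : ℕ) = m then u else b (m - 1 - (m - 1 - i))) :
        Fin (m + 1) → Ω) = Fin.cons u fun l : Fin m => Z i l := by
    intro i
    congr 1
    funext l
    have hl := l.isLt
    have h1 : m - 1 - (m - 1 - (l : ℕ)) = l := by omega
    have h2 : ∀ n, ¬ m - 1 - n = m := by omega
    simp only [hZ, h1, h2, if_false]
    by_cases h : (l : ℕ) < i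
    · simp only [if_pos h]
    · have h3 : m - 1 - (m - 1 - (i : ℕ)) = i := by omega
      simp only [if_neg h, h3]
  simp only [hconf]
  have hlip : ∑ i : Fin (m + 1), w (Fin.cons u fun l : Fin m => Z i l) -
      ∑ i : Fin (m + 1), w (Fin.cons u fun l : Fin m => X i l) ≤
      ∑ i ∈ Finset.range (m + 1), ∑ l ∈ Finset.range m, dist (X i l) (Z i l) := by
    rw [← Finset.sum_sub_distrib, Finset.sum_range]
    refine Finset.sum_le_sum fun i _ => (apply_sub_le_sum_dist hw _ _).trans_eq ?_
    rw [Fin.sum_univ_succ, Finset.sum_range]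
    simp [dist_comm]
  rw [sum_range_succ_sum_range_eq_hooks] at hlip
  have hsum : ∑ c ∈ Finset.range m, (∑ l ∈ Finset.Ico c m, dist (X c l) (Z c l) +
        ∑ j ∈ Finset.Ico (c + 1) (m + 1), dist (X j c) (Z j c)) ≤
      ∑ c ∈ Finset.range m, (Δ * ((m - c : ℕ) : ℝ) ^ 2 -
        ∑ j ∈ Finset.Ico (c + 1) (m + 1), ∑ l ∈ Finset.Ico c m, dist (X c l) (X j c)) := by
    refine Finset.sum_le_sum fun c _ => ?_
    have h := hb c
    rw [Nat.card_Ico] at h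
    refine le_of_eq_of_le ?_ h
    congr 1
    · refine Finset.sum_congr rfl fun l hl => ?_
      simp only [hZ, if_neg (not_lt.mpr (Finset.mem_Ico.mp hl).1)]
    · refine Finset.sum_congr rfl fun j hj => ?_
      simp only [hZ, if_pos (Nat.lt_of_succ_le (Finset.mem_Ico.mp hj).1)]
  rw [Finset.sum_sub_distrib, ← Finset.mul_sum, sum_range_sub_sq] at hsum
  linarith

end Antipodes

/-- The canonical form of the Coester–Koutsoupias potential (for `k = m+1` servers):
the canonical potential with the pairwise distance penalties equals the original
potential `Σ_{i=1}^{k+1} w(x̄_{i−1}^{i−1} x_i … x_k)` up to the constant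
`Δ·Σ_{j=1}^{k−1} j²`. -/
theorem canonical_form_coester_koutsoupias {Ω : Type*} [MetricSpace Ω] [Nonempty Ω]
    (Δ : ℝ) (bar : Ω → Ω) (hbar : ∀ x y : Ω, dist x y + dist y (bar x) = Δ)
    (m : ℕ) (w : (Fin (m + 1) → Ω) → ℝ)
    (hw : ∀ X Y : Fin (m + 1) → Ω, |w X - w Y| ≤ confDist X Y) :
    (⨅ (u : Ω) (x : Fin (m + 1) → Fin m → Ω),
        (w (fun _ => bar u) + (∑ i, w (Fin.cons u (x i))) -
          ∑ i : Fin (m + 1), ∑ j : Fin (m + 1),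
            (if h : (i : ℕ) < (j : ℕ) then
              ∑ l ∈ (Finset.Icc (i : ℕ) (m - 1)).attach,
                dist
                  (x i ⟨l.1, by
                    have hj := j.isLt
                    have hl := (Finset.mem_Icc.mp l.2).2
                    omega⟩)
                  (x j ⟨(i : ℕ), by have hj := j.isLt; omega⟩)
            else 0))) =
      (⨅ x : Fin (m + 1) → Ω,
        ∑ s ∈ (Finset.range (m + 2)).attach,
          w (fun j : Fin (m + 1) =>
            if h : (j : ℕ) < s.1 then
              bar (x ⟨s.1 - 1, by
                have hs := Finset.mem_range.mp s.2
                have hj := j.isLt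
                omega⟩)
            else x j)) -
        Δ * ∑ j ∈ Finset.range (m + 1), (j : ℝ)^2 := by
  set C := Δ * ∑ j ∈ Finset.range (m + 1), (j : ℝ) ^ 2
  have hΔ := dist_le_of_antipodes hbar
  set G : (Fin (m + 1) → Ω) → ℝ := fun x => ∑ s ∈ (Finset.range (m + 2)).attach,
    w (fun j : Fin (m + 1) =>
      if h : (j : ℕ) < s.1 then
        bar (x ⟨s.1 - 1, by
          have hs := Finset.mem_range.mp s.2
          have hj := j.isLt
          omega⟩)
      else x j)
  set F : Ω → (Fin (m + 1) → Fin m → Ω) → ℝ := fun u x =>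
    (w (fun _ => bar u) + (∑ i, w (Fin.cons u (x i))) -
      ∑ i : Fin (m + 1), ∑ j : Fin (m + 1),
        (if h : (i : ℕ) < (j : ℕ) then
          ∑ l ∈ (Finset.Icc (i : ℕ) (m - 1)).attach,
            dist
              (x i ⟨l.1, by
                have hj := j.isLt
                have hl := (Finset.mem_Icc.mp l.2).2
                omega⟩)
              (x j ⟨(i : ℕ), by have hj := j.isLt; omega⟩)
        else 0))
  change (⨅ u, ⨅ x, F u x) = (⨅ x, G x) - C
  have hGY : ∀ Y : ℕ → Ω, G (fun j => Y j) = w (fun _ => bar (Y m)) +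
      ∑ i : Fin (m + 1), w (Fin.cons (Y m) fun l : Fin m =>
        if (l : ℕ) < i then Y (m - 1 - l) else bar (Y (m - 1 - i))) := by
    intro Y
    rw [← sum_potential_eq m hw Y]
    exact Finset.sum_attach (Finset.range (m + 2)) fun s =>
      w (fun j : Fin (m + 1) => if (j : ℕ) < s then bar (Y (s - 1)) else Y j)
  have hFX : ∀ u (X : ℕ → ℕ → Ω), F u (fun i l => X i l) = w (fun _ => bar u) +
      ∑ i : Fin (m + 1), w (Fin.cons u fun l : Fin m => X i l) -
        ∑ c ∈ Finset.range m, ∑ j ∈ Finset.Ico (c + 1) (m + 1), ∑ l ∈ Finset.Ico c m,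
          dist (X c l) (X j c) := by
    intro u X
    rw [← sum_penalty_eq m X]
    rfl
  have hG_bdd : BddBelow (Set.range G) := by
    let z : Fin (m + 1) → Ω := fun _ => Classical.arbitrary Ω
    have hwz : ∀ X, w z - (m + 1) * Δ ≤ w X := fun X => by
      have h := (apply_sub_le_sum_dist hw z X).trans
        (Finset.sum_le_sum fun i _ => hΔ (z i) (X i))
      simp at h
      linarith
    refine ⟨∑ s ∈ (Finset.range (m + 2)).attach, (w z - (m + 1) * Δ), ?_⟩
    rintro _ ⟨x, rfl⟩
    exact Finset.sum_le_sum fun s _ => hwz _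
  have hle : ∀ u x, (⨅ x, G x) - C ≤ F u x := by
    intro u x
    obtain ⟨X, rfl⟩ : ∃ X : ℕ → ℕ → Ω, x = fun (i : Fin (m + 1)) (l : Fin m) => X i l :=
      ⟨fun i l => if h : i < m + 1 ∧ l < m then x ⟨i, h.1⟩ ⟨l, h.2⟩ else u, by
        funext i l
        simp [show (i : ℕ) < m + 1 from i.isLt, -Order.lt_add_one_iff]⟩
    obtain ⟨Y, rfl, hY⟩ := exists_antipodal_le hbar m hw u X
    have h := ciInf_le hG_bdd fun j => Y j
    rw [hGY] at h
    rw [hFX]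
    linarith
  refine le_antisymm ?_ (le_ciInf fun u => le_ciInf fun x => hle u x)
  rw [le_sub_iff_add_le]
  refine le_ciInf fun y => ?_
  obtain ⟨Y, rfl⟩ : ∃ Y : ℕ → Ω, y = fun j : Fin (m + 1) => Y j :=
    ⟨fun n => if h : n < m + 1 then y ⟨n, h⟩ else y 0, by
      funext j
      simp [show (j : ℕ) < m + 1 from j.isLt, -Order.lt_add_one_iff]⟩
  set X : ℕ → ℕ → Ω := fun i l => if l < i then Y (m - 1 - l) else bar (Y (m - 1 - i))
  have h1 : (⨅ u, ⨅ x, F u x) ≤ ⨅ x, F (Y m) x :=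
    ciInf_le ⟨_, by rintro _ ⟨u, rfl⟩; exact le_ciInf fun x => hle u x⟩ (Y m)
  have h2 : (⨅ x, F (Y m) x) ≤ F (Y m) fun i l => X i l :=
    ciInf_le ⟨_, by rintro _ ⟨x, rfl⟩; exact hle (Y m) x⟩ _
  rw [hFX, sum_penalty_antipodal hbar m Y fun _ _ => rfl] at h2
  rw [hGY]
  linarith
end
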